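/- Let F be the free group on x, y, z and let r₁ = z⁻²x⁻¹(y⁻¹z²yx⁻¹y⁻¹z²)²yx⁻¹z⁻²y, r₂ = z⁻²(yx⁻¹y⁻¹z²)²xz²x⁻¹(z⁻²yxy⁻¹)² ∈ F. If D : F → ℤ[F] is a Fox derivative with respect to y (i.e. D(y) = 1, D(x) = D(z) = 0, and D(uv) = D(u) + u·D(v) for all u, v ∈ F), and Φ : ℤ[F] → ℤ[t,t⁻¹] is the ring homomorphism induced by x ↦ −1, y ↦ −t, z ↦ −1, then Φ(D(r₁)) = 0 and Φ(D(r₂)) = 0. -/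

import Mathlib

open LaurentPolynomial

/-- The free group on three generators `x`, `y`, `z`. -/
abbrev F : Type := FreeGroup (Fin 3)

def x : F := FreeGroup.of 0
def y : F := FreeGroup.of 1
def z : F := FreeGroup.of 2

/-- r₁ = z⁻²x⁻¹(y⁻¹z²yx⁻¹y⁻¹z²)²yx⁻¹z⁻²y -/
def r₁ : F :=
  (z ^ 2)⁻¹ * x⁻¹ * (y⁻¹ * z ^ 2 * y * x⁻¹ * y⁻¹ * z ^ 2) ^ 2 * y * x⁻¹ * (z ^ 2)⁻¹ * y

/-- r₂ = z⁻²(yx⁻¹y⁻¹z²)²xz²x⁻¹(z⁻²yxy⁻¹)² -/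
def r₂ : F :=
  (z ^ 2)⁻¹ * (y * x⁻¹ * y⁻¹ * z ^ 2) ^ 2 * x * z ^ 2 * x⁻¹ * ((z ^ 2)⁻¹ * y * x * y⁻¹) ^ 2

/-- μ = z(yx⁻¹y⁻¹z²)²x -/
def μ : F := z * (y * x⁻¹ * y⁻¹ * z ^ 2) ^ 2 * x

/-- λ = x⁻¹(z⁻²yxy⁻¹)²(yx⁻¹y⁻¹z²)²xz² -/
def lam : F :=
  x⁻¹ * ((z ^ 2)⁻¹ * y * x * y⁻¹) ^ 2 * (y * x⁻¹ * y⁻¹ * z ^ 2) ^ 2 * x * z ^ 2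

/-- s_k = μλᵏ -/
def s (k : ℕ) : F := μ * lam ^ k

/-- A crossed homomorphism kills the identity. -/
theorem crossedHom_one {G R : Type*} [Group G] [Ring R] {p : G →* R} {d : G → R}
    (hd : ∀ u v, d (u * v) = d u + p u * d v) : d 1 = 0 := by
  simpa using hd 1 1

theorem crossedHom_inv {G R : Type*} [Group G] [Ring R] {p : G →* R} {d : G → R}
    (hd : ∀ u v, d (u * v) = d u + p u * d v) (u : G) : d u⁻¹ = -(p u⁻¹ * d u) := by
  have h := hd u⁻¹ u
  rw [inv_mul_cancel, crossedHom_one hd] at h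
  exact eq_neg_of_add_eq_zero_left h.symm

/-- if `D` is the Fox derivative with respect to `y` and `Φ` is the ring
homomorphism `ℤ[F] → ℤ[t,t⁻¹]` induced by `x ↦ -1`, `y ↦ -t`, `z ↦ -1`, then
`Φ(D(r₁)) = 0` and `Φ(D(r₂)) = 0`. -/
theorem fox_derivative_y_vanishes
    (D : F → MonoidAlgebra ℤ F)
    (hDy : D y = 1) (hDx : D x = 0) (hDz : D z = 0)
    (hD : ∀ u v : F, D (u * v) = D u + MonoidAlgebra.of ℤ F u * D v)
    (Φ : MonoidAlgebra ℤ F →+* LaurentPolynomial ℤ)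
    (hΦx : Φ (MonoidAlgebra.of ℤ F x) = -1)
    (hΦy : Φ (MonoidAlgebra.of ℤ F y) = -(T 1))
    (hΦz : Φ (MonoidAlgebra.of ℤ F z) = -1) :
    Φ (D r₁) = 0 ∧ Φ (D r₂) = 0 := by
  let p : F →* LaurentPolynomial ℤ := (Φ : _ →* _).comp (MonoidAlgebra.of ℤ F)
  let d : F → LaurentPolynomial ℤ := fun u => Φ (D u)
  have hd : ∀ u v, d (u * v) = d u + p u * d v := fun u v => by simp [d, p, hD]
  have hdx : d x = 0 := by simp [d, hDx]
  have hdy : d y = 1 := by simp [d, hDy]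
  have hdz : d z = 0 := by simp [d, hDz]
  have hpx : p x = -1 := hΦx
  have hpy : p y = -T 1 := hΦy
  have hpz : p z = -1 := hΦz
  have hpx' : p x⁻¹ = -1 := by
    have h : p x⁻¹ * p x = 1 := by rw [← map_mul, inv_mul_cancel, map_one]
    rw [hpx] at h
    linear_combination -h
  have hpz' : p z⁻¹ = -1 := by
    have h : p z⁻¹ * p z = 1 := by rw [← map_mul, inv_mul_cancel, map_one]
    rw [hpz] at h
    linear_combination -h
  have hy : p y⁻¹ * p y = 1 := by rw [← map_mul, inv_mul_cancel, map_one]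
  rw [hpy] at hy
  change d r₁ = 0 ∧ d r₂ = 0
  simp only [r₁, r₂, pow_two, mul_inv_rev, hd, crossedHom_inv hd, map_mul, hdx, hdy, hdz,
    hpx, hpy, hpz, hpx', hpz']
  generalize p y⁻¹ = q at *
  generalize (T 1 : LaurentPolynomial ℤ) = t at *
  constructor
  · grind
  · grind
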